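/- Let $S^*$ be the majorant of the partial sums of the Haar series $\sum_{n=1}^\infty \sum_{i=1}^n 2^{(k_n+i)/2}\, \chi_{k_n+i}^{(\alpha(n,i))}(x)$, where $k_n = n(n-1)/2$ and $\alpha(n,i) = (1-2^{-(i-1)})2^{k_n+i}+1$. Then it is impossible to partition $[0,1]$ into finitely many intervals $I_1,\dots,I_s$ such that for every $k$, $\liminf_{\lambda \to \infty} \lambda\, \mu\{x \in I_k : S^*(x) > \lambda\} = 0$. -/

import Mathlib

open MeasureTheory Filter Topology

noncomputable section

/-- `k_n = n(n-1)/2`. -/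
def ksq (n : ℕ) : ℕ := n * (n - 1) / 2

/-- `α(n,i) = (1 - 2^{-(i-1)}) 2^{k_n+i} + 1 = 2^{k_n+i} - 2^{k_n+1} + 1`. -/
def alph (n i : ℕ) : ℕ := 2 ^ (ksq n + i) - 2 ^ (ksq n + 1) + 1

/-- The Haar function `χ_k^{(i)}` (two-index notation, `n = 2^k + i`, `1 ≤ i ≤ 2^k`):
`2^{k/2}` on `((i-1)/2^k, (2i-1)/2^{k+1})`, `-2^{k/2}` on `((2i-1)/2^{k+1}, i/2^k)`, `0`
outside `[(i-1)/2^k, i/2^k]` (values at the finitely many break points are immaterial). -/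
def haar (k i : ℕ) (x : ℝ) : ℝ :=
  if ((i : ℝ) - 1) / 2 ^ k < x ∧ x < (2 * (i : ℝ) - 1) / 2 ^ (k + 1) then
    (2 : ℝ) ^ ((k : ℝ) / 2)
  else if (2 * (i : ℝ) - 1) / 2 ^ (k + 1) < x ∧ x < (i : ℝ) / 2 ^ k then
    -((2 : ℝ) ^ ((k : ℝ) / 2))
  else 0

/-- The `N`-th partial sum `∑_{n ≤ N} a_n χ_n(x)` (single-index enumeration) of the Haar
series `∑_{n=1}^∞ ∑_{i=1}^n 2^{(k_n+i)/2} χ_{k_n+i}^{(α(n,i))}`: its terms are the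
functions `2^{(k_n+i)/2} χ_{k_n+i}^{(α(n,i))}` with single index `2^{k_n+i} + α(n,i)`, and
all other coefficients vanish.  (Terms with outer index `n > N` have single index
`≥ 2^{k_n+1} + 1 > N`, so the outer cut-off at `N` loses nothing.) -/
def pSum (N : ℕ) (x : ℝ) : ℝ :=
  ∑ n ∈ Finset.Icc 1 N, ∑ i ∈ Finset.Icc 1 n,
    if 2 ^ (ksq n + i) + alph n i ≤ N then
      (2 : ℝ) ^ ((ksq n + i : ℝ) / 2) * haar (ksq n + i) (alph n i) x
    else 0

lemma ksq_succ (n : ℕ) : ksq (n + 1) = ksq n + n := by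
  unfold ksq
  rw [← Finset.sum_range_id_mul_two, ← Finset.sum_range_id_mul_two, Finset.sum_range_succ]
  omega

lemma ksq_mono : Monotone ksq :=
  monotone_nat_of_le_succ fun n => by rw [ksq_succ]; omega

lemma le_ksq_add_one (n : ℕ) : n ≤ ksq n + 1 := by
  cases n with
  | zero => omega
  | succ n => rw [ksq_succ]; omega

lemma ksq_add_lt_of_lt {n i m j : ℕ} (hi : i ≤ n) (hj : 1 ≤ j) (h : n < m) :
    ksq n + i < ksq m + j := by
  have := ksq_mono (Nat.succ_le_of_lt h)
  rw [Nat.succ_eq_add_one, ksq_succ] at this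
  omega

lemma ksq_add_injective {n i m j : ℕ} (hi1 : 1 ≤ i) (hi : i ≤ n) (hj1 : 1 ≤ j) (hj : j ≤ m)
    (h : ksq n + i = ksq m + j) : n = m ∧ i = j := by
  rcases lt_trichotomy n m with hnm | rfl | hnm
  · have := ksq_add_lt_of_lt hi hj1 hnm
    omega
  · omega
  · have := ksq_add_lt_of_lt hj hi1 hnm
    omega

lemma exists_ksq_add (K : ℕ) : ∃ n i, 1 ≤ i ∧ i ≤ n ∧ K + 1 = ksq n + i := by
  induction K with
  | zero => exact ⟨1, 1, le_rfl, le_rfl, by simp [ksq]⟩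
  | succ K ih =>
    obtain ⟨n, i, hi1, hi, h⟩ := ih
    rcases hi.lt_or_eq with hlt | rfl
    · exact ⟨n, i + 1, by omega, hlt, by omega⟩
    · exact ⟨i + 1, 1, le_rfl, by omega, by rw [ksq_succ]; omega⟩

lemma alph_pos (n i : ℕ) : 1 ≤ alph n i := Nat.le_add_left _ _

lemma alph_le (n : ℕ) {i : ℕ} (hi : 1 ≤ i) : alph n i ≤ 2 ^ (ksq n + i) := by
  have h1 : 2 ^ (ksq n + 1) ≤ 2 ^ (ksq n + i) := Nat.pow_le_pow_right (by norm_num) (by omega)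
  have h2 : 0 < 2 ^ (ksq n + 1) := by positivity
  unfold alph
  omega

lemma pow_add_injective {K L a b : ℕ} (ha1 : 1 ≤ a) (ha : a ≤ 2 ^ K) (hb1 : 1 ≤ b)
    (hb : b ≤ 2 ^ L) (h : 2 ^ K + a = 2 ^ L + b) : K = L := by
  rcases lt_trichotomy K L with hKL | hKL | hKL
  · have : 2 ^ (K + 1) ≤ 2 ^ L := Nat.pow_le_pow_right (by norm_num) hKL
    rw [pow_succ] at this
    omega
  · exact hKL
  · have : 2 ^ (L + 1) ≤ 2 ^ K := Nat.pow_le_pow_right (by norm_num) hKL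
    rw [pow_succ] at this
    omega

lemma index_injective {n i m j : ℕ} (hi1 : 1 ≤ i) (hi : i ≤ n) (hj1 : 1 ≤ j) (hj : j ≤ m)
    (h : 2 ^ (ksq n + i) + alph n i = 2 ^ (ksq m + j) + alph m j) : n = m ∧ i = j :=
  ksq_add_injective hi1 hi hj1 hj <|
    pow_add_injective (alph_pos _ _) (alph_le n hi1) (alph_pos _ _) (alph_le m hj1) h

lemma lt_index (n : ℕ) {i : ℕ} (hi : 1 ≤ i) : n < 2 ^ (ksq n + i) + alph n i := by
  have h1 := le_ksq_add_one n
  have h2 : ksq n + i < 2 ^ (ksq n + i) := Nat.lt_two_pow_self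
  omega

/-- Enlarging the outer cut-off does not change the partial sum. -/
lemma pSum_eq_of_le {M L : ℕ} (h : M ≤ L) (x : ℝ) :
    pSum M x = ∑ n ∈ Finset.Icc 1 L, ∑ i ∈ Finset.Icc 1 n,
      if 2 ^ (ksq n + i) + alph n i ≤ M then
        (2 : ℝ) ^ ((ksq n + i : ℝ) / 2) * haar (ksq n + i) (alph n i) x
      else 0 := by
  unfold pSum
  refine Finset.sum_subset (Finset.Icc_subset_Icc le_rfl h) fun n hn hn' => ?_
  refine Finset.sum_eq_zero fun i hi => ?_
  simp only [Finset.mem_Icc] at hn hn' hi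
  have := lt_index n hi.1
  rw [if_neg (by omega)]

/-- Two consecutive partial sums differ by a single term of the series. -/
lemma pSum_index_sub (n i : ℕ) (hi1 : 1 ≤ i) (hi : i ≤ n) (x : ℝ) :
    pSum (2 ^ (ksq n + i) + alph n i) x - pSum (2 ^ (ksq n + i) + alph n i - 1) x =
      (2 : ℝ) ^ ((ksq n + i : ℝ) / 2) * haar (ksq n + i) (alph n i) x := by
  have hn := lt_index n hi1
  rw [pSum_eq_of_le (Nat.sub_le (2 ^ (ksq n + i) + alph n i) 1), pSum,
    ← Finset.sum_sub_distrib,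
    Finset.sum_eq_single_of_mem n (Finset.mem_Icc.2 ⟨by omega, hn.le⟩), ← Finset.sum_sub_distrib,
    Finset.sum_eq_single_of_mem i (Finset.mem_Icc.2 ⟨hi1, hi⟩)]
  · rw [if_pos le_rfl, if_neg (by omega), sub_zero]
  · intro j hj hji
    rw [Finset.mem_Icc] at hj
    have hne : 2 ^ (ksq n + j) + alph n j ≠ 2 ^ (ksq n + i) + alph n i := fun h =>
      hji (index_injective hj.1 hj.2 hi1 hi h).2
    split_ifs <;> first | omega | simp
  · intro m hm hmn
    rw [← Finset.sum_sub_distrib]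
    refine Finset.sum_eq_zero fun j hj => ?_
    rw [Finset.mem_Icc] at hj
    have hne : 2 ^ (ksq m + j) + alph m j ≠ 2 ^ (ksq n + i) + alph n i := fun h =>
      hmn (index_injective hj.1 hj.2 hi1 hi h).1
    split_ifs <;> first | omega | simp

lemma alph_sub_one_div (n : ℕ) {i : ℕ} (hi : 1 ≤ i) :
    ((alph n i : ℝ) - 1) / 2 ^ (ksq n + i) = 1 - 2 * (1 / 2) ^ i := by
  have h1 : 2 ^ (ksq n + 1) ≤ 2 ^ (ksq n + i) := Nat.pow_le_pow_right (by norm_num) (by omega)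
  unfold alph
  push_cast [Nat.cast_sub h1]
  rw [one_div, inv_pow, pow_add, pow_add]
  field_simp
  ring

/-- On the left half of the support of a term some partial sum is at least half of the term. -/
lemma exists_le_abs_pSum {n i : ℕ} (hi1 : 1 ≤ i) (hi : i ≤ n) {x : ℝ}
    (hx : x ∈ Set.Ioo (1 - 2 * (1 / 2 : ℝ) ^ i)
      (1 - 2 * (1 / 2 : ℝ) ^ i + (1 / 2) ^ (ksq n + i + 1))) :
    ∃ N, (2 : ℝ) ^ (ksq n + i) / 2 ≤ |pSum N x| := by
  have hleft := alph_sub_one_div n hi1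
  have hmid : (2 * (alph n i : ℝ) - 1) / 2 ^ (ksq n + i + 1) =
      1 - 2 * (1 / 2 : ℝ) ^ i + (1 / 2) ^ (ksq n + i + 1) := by
    rw [← hleft, one_div, inv_pow, pow_succ]
    field_simp
    ring
  have hhaar : haar (ksq n + i) (alph n i) x = (2 : ℝ) ^ (((ksq n + i : ℕ) : ℝ) / 2) := by
    rw [haar, if_pos ⟨by rw [hleft]; exact hx.1, by rw [hmid]; exact hx.2⟩]
  have hdiff := pSum_index_sub n i hi1 hi x
  rw [hhaar, Nat.cast_add, ← Real.rpow_add two_pos, add_halves, ← Nat.cast_add,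
    Real.rpow_natCast] at hdiff
  by_contra! hcon
  have h1 := abs_lt.1 (hcon (2 ^ (ksq n + i) + alph n i))
  have h2 := abs_lt.1 (hcon (2 ^ (ksq n + i) + alph n i - 1))
  linarith [h1.2, h2.1]

/-- On an interval with right end point `1` the weak-type quantity stays bounded away from
zero. -/
lemma exists_le_mul_volume {a : ℝ} (ha : a < 1) :
    ∃ ε > (0 : ℝ), ∀ᶠ lam : ℝ in atTop,
      ε ≤ lam * (volume {x ∈ Set.Icc a 1 | ∃ N, lam < |pSum N x|}).toReal := by
  obtain ⟨p, hp⟩ := exists_pow_lt_of_lt_one (sub_pos.2 ha) (by norm_num : (1 / 2 : ℝ) < 1)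
  have hp' : 2 * (1 / 2 : ℝ) ^ (p + 1) < 1 - a := by rw [pow_succ]; linarith
  refine ⟨(1 / 2) ^ (p + 4), by positivity, ?_⟩
  filter_upwards [eventually_ge_atTop ((2 : ℝ) ^ ksq (p + 1))] with lam hlam
  obtain ⟨m, hm, hm'⟩ := exists_nat_pow_near
    ((one_le_pow₀ (by norm_num : (1 : ℝ) ≤ 2)).trans hlam) (by norm_num : (1 : ℝ) < 2)
  have hkm : ksq (p + 1) < m + 1 :=
    (pow_lt_pow_iff_right₀ (by norm_num : (1 : ℝ) < 2)).1 (hlam.trans_lt hm')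
  obtain ⟨n, i, hi1, hi, hK⟩ := exists_ksq_add (m + 1)
  have hn : p + 1 ≤ n := by
    by_contra! hlt
    have := ksq_mono (Nat.succ_le_of_lt hlt)
    rw [Nat.succ_eq_add_one, ksq_succ] at this
    omega
  obtain ⟨j, hj1, hjn, hpj, hij, hjp⟩ :
      ∃ j, 1 ≤ j ∧ j ≤ n ∧ p + 1 ≤ j ∧ i ≤ j ∧ j ≤ i + p :=
    ⟨max i (p + 1), by omega, by omega, by omega, by omega, by omega⟩
  have hhalf : ∀ {u v : ℕ}, u ≤ v → (1 / 2 : ℝ) ^ v ≤ (1 / 2) ^ u := fun h =>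
    pow_le_pow_of_le_one (by norm_num) (by norm_num) h
  have hsub : Set.Ioo (1 - 2 * (1 / 2 : ℝ) ^ j)
      (1 - 2 * (1 / 2 : ℝ) ^ j + (1 / 2) ^ (ksq n + j + 1)) ⊆
      {x ∈ Set.Icc a 1 | ∃ N, lam < |pSum N x|} := by
    intro x hx
    refine ⟨⟨?_, ?_⟩, ?_⟩
    · linarith [hx.1, hhalf hpj]
    · have h1 : (1 / 2 : ℝ) ^ (ksq n + j + 1) ≤ (1 / 2) ^ j := hhalf (by omega)
      have h2 : (0 : ℝ) < (1 / 2) ^ j := by positivity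
      linarith [hx.2]
    · obtain ⟨N, hN⟩ := exists_le_abs_pSum hj1 hjn hx
      refine ⟨N, lt_of_lt_of_le ?_ hN⟩
      have : (2 : ℝ) ^ (m + 1 + 1) ≤ 2 ^ (ksq n + j) :=
        pow_le_pow_right₀ (by norm_num) (by omega)
      rw [pow_succ] at this
      linarith
  have hfin : volume {x ∈ Set.Icc a 1 | ∃ N, lam < |pSum N x|} ≠ ⊤ :=
    measure_ne_top_of_subset (fun x hx => hx.1) measure_Icc_lt_top.ne
  have hvol := ENNReal.toReal_mono hfin (measure_mono hsub)
  rw [Real.volume_Ioo, add_sub_cancel_left, ENNReal.toReal_ofReal (by positivity)] at hvol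
  calc (1 / 2 : ℝ) ^ (p + 4) ≤ 2 ^ m * (1 / 2) ^ (m + p + 3) := by
        rw [show m + p + 3 = m + (p + 3) by ring, pow_add (1 / 2 : ℝ) m, ← mul_assoc, ← mul_pow]
        norm_num
        exact pow_le_pow_of_le_one (by norm_num) (by norm_num) (by omega)
    _ ≤ lam * (1 / 2) ^ (ksq n + j + 1) :=
        mul_le_mul hm (hhalf (by omega)) (by positivity) (le_trans (by positivity) hm)
    _ ≤ _ := mul_le_mul_of_nonneg_left hvol (le_trans (by positivity) hm)

/-- In a finite cover of `[0, 1]` by closed intervals one of them is `[a, 1]` with `a < 1`. -/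
lemma exists_eq_Icc_one {s : ℕ} {J : Fin s → Set ℝ}
    (hJ : ∀ k, ∃ a b : ℝ, a ≤ b ∧ J k = Set.Icc a b) (hU : (⋃ k, J k) = Set.Icc (0 : ℝ) 1) :
    ∃ k, ∃ a < 1, J k = Set.Icc a 1 := by
  have hfreq : ∃ k, ∃ᶠ x in 𝓝[<] (1 : ℝ), x ∈ J k := by
    by_contra! hcon
    obtain ⟨x, hx, hx'⟩ := ((eventually_all.2 hcon).and
      (Ioo_mem_nhdsLT (zero_lt_one' ℝ))).exists
    have : x ∈ ⋃ k, J k := hU ▸ Set.Ioo_subset_Icc_self hx'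
    obtain ⟨k, hk⟩ := Set.mem_iUnion.1 this
    exact hx k hk
  obtain ⟨k, hk⟩ := hfreq
  obtain ⟨a, b, hab, hJk⟩ := hJ k
  rw [hJk] at hk
  obtain ⟨x, hx, hx1⟩ := (hk.and_eventually self_mem_nhdsWithin).exists
  have hb1 : b ≤ 1 := by
    have : b ∈ ⋃ k, J k := Set.mem_iUnion.2 ⟨k, hJk ▸ Set.right_mem_Icc.2 hab⟩
    rw [hU] at this
    exact this.2
  have hb2 : 1 ≤ b := by
    by_contra! hlt
    obtain ⟨y, hy, hy'⟩ := (hk.and_eventually (Ioo_mem_nhdsLT hlt)).exists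
    exact absurd hy.2 (not_le.2 hy'.1)
  exact ⟨k, a, hx.1.trans_lt hx1, by rw [hJk, le_antisymm hb1 hb2]⟩

/-- **Example (no finite partition works).**  For the majorant `S*` of the above Haar
series it is impossible to partition `[0,1]` into finitely many intervals `J 1, …, J s`
(with pairwise disjoint interiors) such that on each of them
`liminf_{λ→∞} λ · μ{x ∈ J k : S*(x) > λ} = 0`  (for a nonnegative quantity, the liminf
being `0` means: for every `ε > 0` the quantity is `< ε` for arbitrarily large `λ`). -/
theorem no_finite_partition :
    ¬ ∃ (s : ℕ) (J : Fin s → Set ℝ),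
      (∀ k, ∃ a b : ℝ, a ≤ b ∧ J k = Set.Icc a b) ∧
      (∀ k l, k ≠ l → Disjoint (interior (J k)) (interior (J l))) ∧
      (⋃ k, J k) = Set.Icc (0 : ℝ) 1 ∧
      (∀ k, ∀ ε > (0 : ℝ), ∃ᶠ lam : ℝ in atTop,
        lam * (volume {x ∈ J k | ∃ N, lam < |pSum N x|}).toReal < ε) := by
  rintro ⟨s, J, hJ, -, hU, h⟩
  obtain ⟨k, a, ha, hk⟩ := exists_eq_Icc_one hJ hU
  obtain ⟨ε, hε, hev⟩ := exists_le_mul_volume ha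
  have hfreq := h k ε hε
  rw [hk] at hfreq
  obtain ⟨lam, h1, h2⟩ := (hfreq.and_eventually hev).exists
  exact absurd h1 (not_lt.2 h2)
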